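/- For every nonnegative integer n, b̅₅(4n+3) = 2·b̅₅(2n). -/

import Mathlib

open scoped BigOperators

/-- The q-Pochhammer infinite product `(a; q)_∞ = ∏_{k≥0} (1 - a q^k)`. -/
noncomputable def qpoch (a q : ℂ) : ℂ := ∏' k : ℕ, (1 - a * q ^ k)

/-- `φ(-q) = (q;q)_∞² / (q²;q²)_∞`. -/
noncomputable def phiNeg (q : ℂ) : ℂ := qpoch q q ^ 2 / qpoch (q ^ 2) (q ^ 2)

/-- `ψ(-q) = (q;q)_∞ (q⁴;q⁴)_∞ / (q²;q²)_∞`. -/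
noncomputable def psiNeg (q : ℂ) : ℂ :=
  qpoch q q * qpoch (q ^ 4) (q ^ 4) / qpoch (q ^ 2) (q ^ 2)

open Filter Topology Asymptotics

lemma norm_mul_pow_summable (a : ℂ) {p : ℂ} (hp : ‖p‖ < 1) :
    Summable (fun k : ℕ => ‖a * p ^ k‖) := by
  simp only [norm_mul, norm_pow]
  exact (summable_geometric_of_lt_one (norm_nonneg _) hp).mul_left _

lemma qpoch_multipliable (a : ℂ) {p : ℂ} (hp : ‖p‖ < 1) :
    Multipliable (fun k : ℕ => 1 - a * p ^ k) := by
  have := multipliable_one_add_of_summable (f := fun k : ℕ => -(a * p ^ k))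
    (by simpa using norm_mul_pow_summable a hp)
  simpa [sub_eq_add_neg] using this

lemma qpoch_succ (a : ℂ) {p : ℂ} (hp : ‖p‖ < 1) :
    qpoch a p = (1 - a) * qpoch (p * a) p := by
  unfold qpoch
  have e : ∀ k : ℕ, 1 - p * a * p ^ k = 1 - a * p ^ (k + 1) := by
    intro k; ring
  have h : Multipliable (fun k : ℕ => 1 - a * p ^ (k + 1)) :=
    (qpoch_multipliable (p * a) hp).congr e
  have h2 := tprod_eq_zero_mul' (f := fun k : ℕ => 1 - a * p ^ k) h
  simp only [pow_zero, mul_one] at h2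
  rw [tprod_congr e]
  exact h2

lemma qpoch_ne_zero {a p : ℂ} (hp : ‖p‖ < 1) (ha : ‖a‖ < 1) : qpoch a p ≠ 0 := by
  unfold qpoch
  have := tprod_one_add_ne_zero_of_summable (f := fun k : ℕ => -(a * p ^ k)) ?_
    (by simpa using norm_mul_pow_summable a hp)
  · simpa [sub_eq_add_neg] using this
  · intro k h
    have h1 : a * p ^ k = 1 := by linear_combination -h
    have h2 : ‖a * p ^ k‖ < 1 := by
      rw [norm_mul, norm_pow]
      exact mul_lt_one_of_nonneg_of_lt_one_left (norm_nonneg _) ha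
        (pow_le_one₀ (norm_nonneg _) hp.le)
    rw [h1] at h2
    simp at h2

lemma qpoch_differentiable {p : ℂ} (hp : ‖p‖ < 1) : Differentiable ℂ (fun z => qpoch z p) := by
  intro z
  have hs : Summable (fun k : ℕ => (‖z‖ + 1) * ‖p‖ ^ k) :=
    (summable_geometric_of_lt_one (norm_nonneg _) hp).mul_left _
  have h := Summable.hasProdLocallyUniformlyOn_nat_one_add (K := Metric.ball (0 : ℂ) (‖z‖ + 1))
    (f := fun (k : ℕ) (w : ℂ) => -(w * p ^ k)) Metric.isOpen_ball hs
    (Eventually.of_forall fun k w hw => by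
      rw [norm_neg, norm_mul, norm_pow]
      gcongr
      exact (mem_ball_zero_iff.1 hw).le)
    (fun k => by fun_prop)
  have h2 := h.differentiableOn (Eventually.of_forall fun s => by fun_prop) Metric.isOpen_ball
  have h3 := h2.differentiableAt (x := z) (Metric.isOpen_ball.mem_nhds (by simp))
  simpa [qpoch, sub_eq_add_neg] using h3

/-- `x / (1 - x)²`. -/
noncomputable def sqf (x : ℂ) : ℂ := x / (1 - x) ^ 2

/-- Lambert-type sum. -/
noncomputable def lam (p z : ℂ) : ℂ := ∑' k : ℕ, sqf (z * p ^ k)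

lemma sqf_bound {x : ℂ} {r : ℝ} (hr : r < 1) (hx : ‖x‖ ≤ r) : ‖sqf x‖ ≤ ‖x‖ / (1 - r) ^ 2 := by
  unfold sqf
  rw [norm_div, norm_pow]
  have : 1 - r ≤ ‖1 - x‖ := by
    have := norm_sub_norm_le (1 : ℂ) x
    simp at this
    linarith
  have : 0 < 1 - r := by linarith
  gcongr

lemma sqf_inv (x : ℂ) (hx : x ≠ 0) : sqf (1 / x) = sqf x := by
  unfold sqf
  by_cases h : x = 1
  · simp [h]
  have h1 : 1 - x ≠ 0 := sub_ne_zero.2 (Ne.symm h)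
  have h2 : x - 1 ≠ 0 := sub_ne_zero.2 h
  have h3 : 1 - 1 / x ≠ 0 := by
    field_simp; exact div_ne_zero h2 hx
  field_simp
  ring

lemma lam_summable (z : ℂ) {p : ℂ} (hp : ‖p‖ < 1) : Summable (fun k : ℕ => sqf (z * p ^ k)) := by
  have h0 : Tendsto (fun k : ℕ => ‖z * p ^ k‖) atTop (𝓝 0) :=
    (norm_mul_pow_summable z hp).tendsto_atTop_zero
  have h1 : ∀ᶠ k in atTop, ‖z * p ^ k‖ ≤ 1 / 2 := h0.eventually_le_const (by norm_num)
  refine Summable.of_norm_bounded_eventually_nat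
    ((norm_mul_pow_summable z hp).div_const ((1 - 1 / 2) ^ 2)) ?_
  filter_upwards [h1] with k hk
  exact sqf_bound (by norm_num) hk

lemma lam_succ (z : ℂ) {p : ℂ} (hp : ‖p‖ < 1) : lam p z = sqf z + lam p (p * z) := by
  unfold lam
  rw [(lam_summable z hp).tsum_eq_zero_add]
  simp only [pow_zero, mul_one]
  congr 2
  ext k
  congr 1
  ring

lemma lam_differentiableAt {p z : ℂ} (hp : ‖p‖ < 1) (hz : ‖z‖ < 1) :
    DifferentiableAt ℂ (lam p) z := by
  obtain ⟨r, hzr, hr⟩ := exists_between hz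
  have hr0 : 0 ≤ r := (norm_nonneg z).trans hzr.le
  have hs : Summable (fun k : ℕ => r / (1 - r) ^ 2 * ‖p‖ ^ k) :=
    (summable_geometric_of_lt_one (norm_nonneg _) hp).mul_left _
  have hb : ∀ (k : ℕ) (w : ℂ), w ∈ Metric.ball (0 : ℂ) r → ‖w * p ^ k‖ ≤ r * ‖p‖ ^ k := by
    intro k w hw
    rw [norm_mul, norm_pow]
    gcongr
    exact (mem_ball_zero_iff.1 hw).le
  have hb' : ∀ (k : ℕ) (w : ℂ), w ∈ Metric.ball (0 : ℂ) r → ‖w * p ^ k‖ ≤ r := by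
    intro k w hw
    exact (hb k w hw).trans (mul_le_of_le_one_right hr0 (pow_le_one₀ (norm_nonneg _) hp.le))
  have := Complex.differentiableOn_tsum_of_summable_norm (U := Metric.ball (0 : ℂ) r)
    (F := fun (k : ℕ) w => sqf (w * p ^ k)) hs ?_ Metric.isOpen_ball ?_
  · exact this.differentiableAt (Metric.isOpen_ball.mem_nhds (by simpa using hzr))
  · intro k w hw
    have h1 : (1 - w * p ^ k) ^ 2 ≠ 0 := by
      apply pow_ne_zero
      intro h
      have h1 : w * p ^ k = 1 := by linear_combination -h
      have := hb' k w hw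
      rw [h1] at this
      simp at this
      linarith
    have h2 : DifferentiableAt ℂ (fun w : ℂ => w * p ^ k / (1 - w * p ^ k) ^ 2) w :=
      DifferentiableAt.fun_div (by fun_prop) (by fun_prop) h1
    exact h2.differentiableWithinAt
  · intro k w hw
    refine (sqf_bound hr (hb' k w hw)).trans ?_
    have := hb k w hw
    rw [div_mul_eq_mul_div]
    gcongr

/-- Theta product. -/
noncomputable def tht (p z : ℂ) : ℂ := qpoch z p * qpoch (p / z) p

/-- Weierstrass-type function. -/
noncomputable def wp (p z : ℂ) : ℂ := lam p z + lam p (p / z)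

lemma tht_inv {p : ℂ} (hp : ‖p‖ < 1) {z : ℂ} (hz : z ≠ 0) : tht p (1 / z) = - tht p z / z := by
  unfold tht
  rw [qpoch_succ z hp, qpoch_succ (1 / z) hp]
  have e1 : p / (1 / z) = p * z := by field_simp
  have e2 : p * (1 / z) = p / z := by field_simp
  rw [e1, e2]
  field_simp
  ring

lemma tht_mul {p : ℂ} (hp : ‖p‖ < 1) (hp0 : p ≠ 0) {z : ℂ} (hz : z ≠ 0) :
    tht p (p * z) = - tht p z / z := by
  rw [← tht_inv hp hz]
  unfold tht
  have e1 : p / (1 / z) = p * z := by field_simp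
  have e2 : p / (p * z) = 1 / z := by field_simp
  rw [e1, e2, mul_comm]

lemma wp_inv {p : ℂ} (hp : ‖p‖ < 1) {z : ℂ} (hz : z ≠ 0) : wp p (1 / z) = wp p z := by
  unfold wp
  rw [lam_succ z hp, lam_succ (1 / z) hp, sqf_inv z hz]
  have e1 : p / (1 / z) = p * z := by field_simp
  have e2 : p * (1 / z) = p / z := by field_simp
  rw [e1, e2]
  ring

lemma wp_mul {p : ℂ} (hp : ‖p‖ < 1) (hp0 : p ≠ 0) {z : ℂ} (hz : z ≠ 0) :
    wp p (p * z) = wp p z := by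
  rw [← wp_inv hp hz]
  unfold wp
  have e1 : p / (1 / z) = p * z := by field_simp
  have e2 : p / (p * z) = 1 / z := by field_simp
  rw [e1, e2, add_comm]

/-- The difference function. -/
noncomputable def dif (p b z : ℂ) : ℂ :=
  wp p z - qpoch p p ^ 4 / tht p b ^ 2 * (z * tht p (b / z) * tht p (b * z) / tht p z ^ 2)

lemma dif_inv {p : ℂ} (hp : ‖p‖ < 1) (b : ℂ) {z : ℂ} (hz : z ≠ 0) :
    dif p b (1 / z) = dif p b z := by
  unfold dif
  rw [wp_inv hp hz, tht_inv hp hz]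
  have e1 : b / (1 / z) = b * z := by field_simp
  have e2 : b * (1 / z) = b / z := by field_simp
  rw [e1, e2]
  congr 2
  by_cases h : tht p z = 0
  · simp [h]
  · field_simp

lemma dif_mul {p : ℂ} (hp : ‖p‖ < 1) (hp0 : p ≠ 0) {b : ℂ} (hb : b ≠ 0) {z : ℂ} (hz : z ≠ 0) :
    dif p b (p * z) = dif p b z := by
  unfold dif
  have h1 := tht_mul hp hp0 (z := b * z) (by positivity)
  have h2 := tht_mul hp hp0 (z := b / (p * z)) (by positivity)
  have e1 : p * (b * z) = b * (p * z) := by ring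
  have e2 : p * (b / (p * z)) = b / z := by field_simp
  rw [e1] at h1
  rw [e2] at h2
  rw [wp_mul hp hp0 hz, tht_mul hp hp0 hz, h1, h2]
  congr 2
  by_cases h : tht p z = 0
  · simp [h]
  · field_simp

/-- Regularised numerator. -/
noncomputable def reg (p b z : ℂ) : ℂ :=
  z + (1 - z) ^ 2 * (lam p (p * z) + lam p (p / z)) -
    qpoch p p ^ 4 / tht p b ^ 2 *
      (z * tht p (b / z) * tht p (b * z) / (qpoch (p * z) p * qpoch (p / z) p) ^ 2)

lemma tht_eq {p : ℂ} (hp : ‖p‖ < 1) (z : ℂ) :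
    tht p z = (1 - z) * (qpoch (p * z) p * qpoch (p / z) p) := by
  unfold tht
  rw [qpoch_succ z hp]
  ring

lemma dif_eq {p : ℂ} (hp : ‖p‖ < 1) (b : ℂ) {z : ℂ} (h1 : z ≠ 1) :
    dif p b z = reg p b z / (1 - z) ^ 2 := by
  have h2 : 1 - z ≠ 0 := sub_ne_zero.2 (Ne.symm h1)
  unfold dif reg wp
  rw [lam_succ z hp, tht_eq hp z, mul_pow, sqf]
  rw [sub_div, add_div, mul_div_cancel_left₀ _ (pow_ne_zero 2 h2), add_assoc]
  congr 1
  rw [mul_div_assoc (qpoch p p ^ 4 / tht p b ^ 2), div_div, mul_comm ((1 - z) ^ 2)]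

lemma reg_inv {p : ℂ} (b : ℂ) {z : ℂ} (hz : z ≠ 0) :
    reg p b (1 / z) = reg p b z / z ^ 2 := by
  unfold reg
  have e1 : b / (1 / z) = b * z := by field_simp
  have e2 : b * (1 / z) = b / z := by field_simp
  have e3 : p / (1 / z) = p * z := by field_simp
  have e4 : p * (1 / z) = p / z := by field_simp
  rw [e1, e2, e3, e4]
  generalize lam p (p * z) = a1
  generalize lam p (p / z) = a2
  generalize qpoch (p * z) p = a3
  generalize qpoch (p / z) p = a4
  rw [mul_comm a4 a3, sub_div]
  congr 1
  · field_simp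
    ring
  · simp only [div_eq_mul_inv]
    field_simp

lemma reg_one {p b : ℂ} (hp : ‖p‖ < 1) (hb : tht p b ≠ 0) : reg p b 1 = 0 := by
  unfold reg
  have : qpoch p p ≠ 0 := qpoch_ne_zero hp hp
  simp
  field_simp
  ring

/-- The open annulus. -/
def ann (p : ℂ) : Set ℂ := {z | ‖p‖ < ‖z‖ ∧ ‖p * z‖ < 1}

lemma ann_open (p : ℂ) : IsOpen (ann p) := by
  unfold ann
  exact (isOpen_lt continuous_const continuous_norm).inter
    (isOpen_lt (continuous_const.mul continuous_id).norm continuous_const)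

lemma one_mem_ann {p : ℂ} (hp : ‖p‖ < 1) : (1 : ℂ) ∈ ann p := by simp [ann, hp]

lemma ann_ne {p z : ℂ} (h : z ∈ ann p) : z ≠ 0 := by
  rintro rfl
  have := h.1
  simp at this
  linarith [norm_nonneg p]

lemma ann_div {p z : ℂ} (h : z ∈ ann p) : ‖p / z‖ < 1 := by
  rw [norm_div, div_lt_one (norm_pos_iff.2 (ann_ne h))]
  exact h.1

lemma tht_differentiableAt {p z : ℂ} (hp : ‖p‖ < 1) (hz : z ≠ 0) :
    DifferentiableAt ℂ (tht p) z := by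
  have h1 : DifferentiableAt ℂ (fun z => p / z) z := by
    fun_prop (disch := assumption)
  exact ((qpoch_differentiable hp) z).mul (((qpoch_differentiable hp) (p / z)).comp z h1)

lemma reg_differentiableAt {p b z : ℂ} (hp : ‖p‖ < 1) (hb : b ≠ 0) (h : z ∈ ann p) :
    DifferentiableAt ℂ (reg p b) z := by
  have hz := ann_ne h
  have h1 : DifferentiableAt ℂ (fun z => p / z) z := by
    fun_prop (disch := assumption)
  have h1' : DifferentiableAt ℂ (fun z => b / z) z := by
    fun_prop (disch := assumption)
  have h2 : DifferentiableAt ℂ (fun z => p * z) z := by fun_prop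
  have h2' : DifferentiableAt ℂ (fun z => b * z) z := by fun_prop
  have l1 : DifferentiableAt ℂ (fun z => lam p (p / z)) z :=
    (lam_differentiableAt hp (ann_div h)).comp z h1
  have l2 : DifferentiableAt ℂ (fun z => lam p (p * z)) z :=
    (lam_differentiableAt hp h.2).comp z h2
  have q1 : DifferentiableAt ℂ (fun z => qpoch (p / z) p) z :=
    ((qpoch_differentiable hp) (p / z)).comp z h1
  have q2 : DifferentiableAt ℂ (fun z => qpoch (p * z) p) z :=
    ((qpoch_differentiable hp) (p * z)).comp z h2
  have t1 : DifferentiableAt ℂ (fun z => tht p (b / z)) z :=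
    (tht_differentiableAt hp (div_ne_zero hb hz)).comp z h1'
  have t2 : DifferentiableAt ℂ (fun z => tht p (b * z)) z :=
    (tht_differentiableAt hp (mul_ne_zero hb hz)).comp z h2'
  have n1 : (qpoch (p * z) p * qpoch (p / z) p) ^ 2 ≠ 0 :=
    pow_ne_zero 2 (mul_ne_zero (qpoch_ne_zero hp h.2) (qpoch_ne_zero hp (ann_div h)))
  unfold reg
  fun_prop (disch := assumption)

lemma reg_deriv {p b : ℂ} (hp : ‖p‖ < 1) (hb0 : b ≠ 0) (hb : tht p b ≠ 0) :
    HasDerivAt (reg p b) 0 1 := by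
  have h := (reg_differentiableAt hp hb0 (one_mem_ann hp)).hasDerivAt
  set m := deriv (reg p b) 1
  have hi : HasDerivAt (fun z : ℂ => 1 / z) (-1) 1 := by
    simpa using hasDerivAt_inv (one_ne_zero : (1 : ℂ) ≠ 0)
  have h1 : HasDerivAt (fun z => reg p b (1 / z)) (m * (-1)) 1 := by
    apply HasDerivAt.comp (h₂ := reg p b) (h := fun z : ℂ => 1 / z) (1 : ℂ) _ hi
    simpa using h
  have h2 : HasDerivAt (fun z => reg p b z / z ^ 2)
      ((m * 1 ^ 2 - reg p b 1 * (2 * 1)) / (1 ^ 2) ^ 2) 1 := by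
    refine h.fun_div ?_ (by simp)
    simpa using hasDerivAt_pow 2 (1 : ℂ)
  have h3 : (fun z => reg p b (1 / z)) =ᶠ[𝓝 1] (fun z => reg p b z / z ^ 2) := by
    filter_upwards [(ann_open p).mem_nhds (one_mem_ann hp)] with z hz
    exact reg_inv b (ann_ne hz)
  have h4 := (h2.congr_of_eventuallyEq h3).unique h1
  rw [reg_one hp hb] at h4
  have : m = 0 := by
    simp at h4
    linear_combination h4 / 2
  rwa [this] at h

lemma dif_little {p b : ℂ} (hp : ‖p‖ < 1) (hb0 : b ≠ 0) (hb : tht p b ≠ 0) :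
    (fun z => dif p b z - dif p b 1) =o[𝓝[≠] 1] fun z => (z - 1)⁻¹ := by
  apply IsLittleO.sub
  · have h := (hasDerivAt_iff_isLittleO.1 (reg_deriv hp hb0 hb)).mono
      (nhdsWithin_le_nhds (s := {(1 : ℂ)}ᶜ))
    simp only [reg_one hp hb, smul_zero, sub_zero] at h
    have h2 := h.mul_isBigO (isBigO_refl (fun z : ℂ => ((z - 1) ^ 2)⁻¹) (𝓝[≠] 1))
    refine h2.congr' ?_ ?_
    · filter_upwards [self_mem_nhdsWithin] with z hz
      rw [dif_eq hp b hz, div_eq_mul_inv]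
      congr 2
      ring
    · filter_upwards [self_mem_nhdsWithin] with z hz
      have : z - 1 ≠ 0 := sub_ne_zero.2 hz
      field_simp
  · apply IsBoundedUnder.isLittleO_sub_self_inv
    exact ⟨‖dif p b 1‖, by simp⟩

/-- Extended difference function. -/
noncomputable def ext0 (p b z : ℂ) : ℂ :=
  open Classical in if tht p z = 0 then limUnder (𝓝[≠] 1) (dif p b) else dif p b z

lemma ext0_mul {p : ℂ} (hp : ‖p‖ < 1) (hp0 : p ≠ 0) {b : ℂ} (hb : b ≠ 0) {z : ℂ} (hz : z ≠ 0) :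
    ext0 p b (p * z) = ext0 p b z := by
  unfold ext0
  rw [dif_mul hp hp0 hb hz, tht_mul hp hp0 hz]
  simp [hz]

lemma ext0_pow {p : ℂ} (hp : ‖p‖ < 1) (hp0 : p ≠ 0) {b : ℂ} (hb : b ≠ 0) {z : ℂ} (hz : z ≠ 0)
    (n : ℕ) : ext0 p b (p ^ n * z) = ext0 p b z := by
  induction n with
  | zero => simp
  | succ n ih =>
    rw [pow_succ', mul_assoc, ext0_mul hp hp0 hb (mul_ne_zero (pow_ne_zero _ hp0) hz), ih]

lemma ext0_zpow {p : ℂ} (hp : ‖p‖ < 1) (hp0 : p ≠ 0) {b : ℂ} (hb : b ≠ 0) {z : ℂ} (hz : z ≠ 0)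
    (n : ℤ) : ext0 p b (p ^ n * z) = ext0 p b z := by
  obtain ⟨k, rfl | rfl⟩ := n.eq_nat_or_neg
  · simpa using ext0_pow hp hp0 hb hz k
  · rw [← ext0_pow hp hp0 hb (z := p ^ (-(k : ℤ)) * z)
      (mul_ne_zero (zpow_ne_zero _ hp0) hz) k]
    congr 1
    rw [← mul_assoc, ← zpow_natCast, ← zpow_add₀ hp0]
    simp

lemma ext0_differentiableOn {p b : ℂ} (hp : ‖p‖ < 1) (hb0 : b ≠ 0) (hb : tht p b ≠ 0) :
    DifferentiableOn ℂ (ext0 p b) (ann p) := by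
  have h := Complex.differentiableOn_update_limUnder_of_isLittleO
    ((ann_open p).mem_nhds (one_mem_ann hp)) (f := dif p b) ?_ (dif_little hp hb0 hb)
  · refine h.congr fun z hz => ?_
    unfold ext0
    by_cases h1 : z = 1
    · subst h1
      simp [tht_eq hp]
    · rw [if_neg, Function.update_of_ne h1]
      rw [tht_eq hp]
      exact mul_ne_zero (sub_ne_zero.2 (Ne.symm h1))
        (mul_ne_zero (qpoch_ne_zero hp hz.2) (qpoch_ne_zero hp (ann_div hz)))
  · intro z hz
    have h1 : z ≠ 1 := hz.2
    have h2 : (1 - z) ^ 2 ≠ 0 := pow_ne_zero 2 (sub_ne_zero.2 (Ne.symm h1))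
    have h3 : DifferentiableAt ℂ (fun z => reg p b z / (1 - z) ^ 2) z :=
      (reg_differentiableAt hp hb0 hz.1).fun_div (by fun_prop) h2
    refine (h3.congr_of_eventuallyEq ?_).differentiableWithinAt
    filter_upwards [isOpen_ne.mem_nhds h1] with w hw
    exact dif_eq hp b hw

lemma exists_zpow_ann {p : ℂ} (hp : ‖p‖ < 1) (hp0 : p ≠ 0) {z : ℂ} (hz : z ≠ 0) :
    ∃ n : ℤ, ‖p‖ < ‖p ^ n * z‖ ∧ ‖p ^ n * z‖ ≤ 1 := by
  have hpp : 0 < ‖p‖ := norm_pos_iff.2 hp0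
  obtain ⟨n, hn⟩ := exists_mem_Ioc_zpow (norm_pos_iff.2 hz) ((one_lt_inv₀ hpp).2 hp)
  have hx : 0 < ‖p‖ ^ (n + 1) := zpow_pos hpp _
  refine ⟨n + 1, ?_, ?_⟩ <;> rw [norm_mul, norm_zpow]
  · have h1 : ‖p‖ ^ (n + 1) * ‖p‖⁻¹ ^ n = ‖p‖ := by
      rw [inv_zpow, zpow_add_one₀ hpp.ne']
      field_simp
    have := mul_lt_mul_of_pos_left hn.1 hx
    rwa [h1] at this
  · have h1 : ‖p‖ ^ (n + 1) * ‖p‖⁻¹ ^ (n + 1) = 1 := by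
      rw [inv_zpow, mul_inv_cancel₀ hx.ne']
    have := mul_le_mul_of_nonneg_left hn.2 hx.le
    rwa [h1] at this

lemma ext0_const {p b : ℂ} (hp : ‖p‖ < 1) (hp0 : p ≠ 0) (hb0 : b ≠ 0) (hb : tht p b ≠ 0)
    {z w : ℂ} (hz : z ≠ 0) (hw : w ≠ 0) : ext0 p b z = ext0 p b w := by
  have hd := ext0_differentiableOn hp hb0 hb
  have hpp : 0 < ‖p‖ := norm_pos_iff.2 hp0
  have hsub : ∀ z : ℂ, ‖p‖ < ‖z‖ → ‖z‖ ≤ 1 → z ∈ ann p := by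
    intro z h1 h2
    refine ⟨h1, ?_⟩
    rw [norm_mul]
    nlinarith
  have hda : ∀ z : ℂ, z ≠ 0 → DifferentiableAt ℂ (ext0 p b) z := by
    intro z hz
    obtain ⟨n, h1, h2⟩ := exists_zpow_ann hp hp0 hz
    have h3 := hd.differentiableAt ((ann_open p).mem_nhds (hsub _ h1 h2))
    have h4 : DifferentiableAt ℂ (fun z => ext0 p b (p ^ n * z)) z :=
      h3.comp z (by fun_prop)
    refine h4.congr_of_eventuallyEq ?_
    filter_upwards [isOpen_ne.mem_nhds hz] with w hw
    exact (ext0_zpow hp hp0 hb0 hw n).symm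
  have hD : Differentiable ℂ (fun u => ext0 p b (Complex.exp u)) := fun u =>
    (hda _ (Complex.exp_ne_zero u)).comp u Complex.differentiable_exp.differentiableAt
  have hK : IsCompact {z : ℂ | ‖p‖ ≤ ‖z‖ ∧ ‖z‖ ≤ 1} := by
    refine (isCompact_closedBall (0 : ℂ) 1).of_isClosed_subset ?_ ?_
    · exact (isClosed_le continuous_const continuous_norm).inter
        (isClosed_le continuous_norm continuous_const)
    · intro z hz
      simpa using hz.2
  have hbd := (hK.image_of_continuousOn (f := ext0 p b) (fun z hz =>
    (hda z (norm_pos_iff.1 (hpp.trans_le hz.1))).continuousAt.continuousWithinAt)).isBounded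
  have := hD.apply_eq_apply_of_bounded (hbd.subset ?_) (Complex.log z) (Complex.log w)
  · simpa [Complex.exp_log hz, Complex.exp_log hw] using this
  · rintro _ ⟨u, rfl⟩
    obtain ⟨n, h1, h2⟩ := exists_zpow_ann hp hp0 (Complex.exp_ne_zero u)
    exact ⟨_, ⟨h1.le, h2⟩, ext0_zpow hp hp0 hb0 (Complex.exp_ne_zero u) n⟩

theorem wp_sub {p a b : ℂ} (hp : ‖p‖ < 1) (hp0 : p ≠ 0) (ha0 : a ≠ 0) (hb0 : b ≠ 0)
    (ha : tht p a ≠ 0) (hb : tht p b ≠ 0) :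
    wp p a - wp p b =
      qpoch p p ^ 4 / tht p b ^ 2 * (a * tht p (b / a) * tht p (b * a) / tht p a ^ 2) := by
  have h := ext0_const hp hp0 hb0 hb ha0 hb0
  unfold ext0 at h
  rw [if_neg ha, if_neg hb] at h
  unfold dif at h
  rw [div_self hb0] at h
  have h1 : tht p 1 = 0 := by simp [tht_eq hp]
  rw [h1] at h
  simp only [mul_zero, zero_mul, zero_div, sub_zero] at h
  linear_combination h

lemma qpoch_two {q : ℂ} (hq : ‖q‖ < 1) :
    qpoch q q = qpoch q (q ^ 2) * qpoch (q ^ 2) (q ^ 2) := by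
  have hq2 : ‖q ^ 2‖ < 1 := by
    rw [norm_pow]; exact pow_lt_one₀ (norm_nonneg _) hq (by norm_num)
  unfold qpoch
  rw [← tprod_even_mul_odd (f := fun k : ℕ => 1 - q * q ^ k)]
  · congr 1 <;> refine tprod_congr fun k => ?_ <;> ring
  · refine (qpoch_multipliable q hq2).congr fun k => ?_
    ring
  · refine (qpoch_multipliable (q ^ 2) hq2).congr fun k => ?_
    ring

lemma qpoch_tendsto (a : ℂ) {p : ℂ} (hp : ‖p‖ < 1) :
    Tendsto (fun n : ℕ => ∏ k ∈ Finset.range n, (1 - a * p ^ k)) atTop (𝓝 (qpoch a p)) :=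
  (qpoch_multipliable a hp).hasProd.tendsto_prod_nat

lemma qpoch_five {q : ℂ} (hq : ‖q‖ < 1) :
    qpoch q q = qpoch q (q ^ 5) * qpoch (q ^ 2) (q ^ 5) * qpoch (q ^ 3) (q ^ 5)
      * qpoch (q ^ 4) (q ^ 5) * qpoch (q ^ 5) (q ^ 5) := by
  have hq5 : ‖q ^ 5‖ < 1 := by
    rw [norm_pow]; exact pow_lt_one₀ (norm_nonneg _) hq (by norm_num)
  have h1 := (qpoch_tendsto q hq).comp (tendsto_id.const_mul_atTop' (show 0 < 5 by norm_num))
  have h2 := ((((qpoch_tendsto q hq5).mul (qpoch_tendsto (q ^ 2) hq5)).mul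
    (qpoch_tendsto (q ^ 3) hq5)).mul (qpoch_tendsto (q ^ 4) hq5)).mul (qpoch_tendsto (q ^ 5) hq5)
  refine tendsto_nhds_unique h1 (h2.congr fun n => ?_)
  simp only [Function.comp_apply, id]
  induction n with
  | zero => simp
  | succ n ih =>
    rw [mul_add, mul_one]
    simp only [Finset.prod_range_succ]
    rw [← ih]
    ring

/-- The quadratic character modulo five. -/
def chi (m : ℕ) : ℂ :=
  if m % 5 = 1 ∨ m % 5 = 4 then 1 else if m % 5 = 2 ∨ m % 5 = 3 then -1 else 0

lemma chi_two (m : ℕ) : chi (2 * m) = - chi m := by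
  have h : m % 5 < 5 := Nat.mod_lt _ (by norm_num)
  have h2 : 2 * m % 5 = 2 * (m % 5) % 5 := by omega
  unfold chi
  rw [h2]
  interval_cases m % 5 <;> simp

/-- The Lambert series. -/
noncomputable def eis (q : ℂ) : ℂ := ∑' m : ℕ, chi m * sqf (q ^ m)

lemma eis_summable {q : ℂ} (hq : ‖q‖ < 1) : Summable (fun m : ℕ => chi m * sqf (q ^ m)) := by
  have h : Summable (fun m : ℕ => ‖sqf (q ^ m)‖) := by
    simpa using (lam_summable 1 hq).norm
  refine Summable.of_norm_bounded h fun m => ?_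
  rw [norm_mul]
  refine mul_le_of_le_one_left (norm_nonneg _) ?_
  unfold chi
  split_ifs <;> simp

lemma eis_eq {q : ℂ} (hq : ‖q‖ < 1) (hq0 : q ≠ 0) :
    eis q = wp (q ^ 5) q - wp (q ^ 5) (q ^ 2) := by
  unfold eis
  rw [Nat.sumByResidueClasses (eis_summable hq) 5]
  have e : ∀ j : ℕ, ∑' m : ℕ, chi (j + 5 * m) * sqf (q ^ (j + 5 * m))
      = chi j * lam (q ^ 5) (q ^ j) := by
    intro j
    unfold lam
    rw [← tsum_mul_left]
    refine tsum_congr fun m => ?_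
    rw [pow_add, pow_mul]
    congr 1
    simp [chi]
  simp only [e]
  have : ∀ F : ZMod 5 → ℂ, ∑ j : ZMod 5, F j = F 0 + F 1 + F 2 + F 3 + F 4 :=
    fun F => Fin.sum_univ_five F
  rw [this]
  have v0 : (0 : ZMod 5).val = 0 := rfl
  have v1 : (1 : ZMod 5).val = 1 := rfl
  have v2 : (2 : ZMod 5).val = 2 := rfl
  have v3 : (3 : ZMod 5).val = 3 := rfl
  have v4 : (4 : ZMod 5).val = 4 := rfl
  rw [v0, v1, v2, v3, v4]
  have e1 : q ^ 5 / q = q ^ 4 := by field_simp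
  have e2 : q ^ 5 / q ^ 2 = q ^ 3 := by field_simp
  unfold wp
  rw [e1, e2]
  simp [chi]
  ring

lemma norm_pow_lt {q : ℂ} (hq : ‖q‖ < 1) {k : ℕ} (hk : k ≠ 0) : ‖q ^ k‖ < 1 := by
  rw [norm_pow]; exact pow_lt_one₀ (norm_nonneg _) hq hk

/-- `(q;q)_∞`. -/
noncomputable def eul (q : ℂ) : ℂ := qpoch q q

lemma eul_ne {q : ℂ} (hq : ‖q‖ < 1) : eul q ≠ 0 := qpoch_ne_zero hq hq

theorem eis_prod {q : ℂ} (hq : ‖q‖ < 1) (hq0 : q ≠ 0) :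
    eis q = q * (eul (q ^ 5) ^ 5 / eul q) := by
  have h5 := norm_pow_lt hq (k := 5) (by norm_num)
  have n1 := qpoch_ne_zero h5 hq
  have n2 := qpoch_ne_zero h5 (norm_pow_lt hq (k := 2) (by norm_num))
  have n3 := qpoch_ne_zero h5 (norm_pow_lt hq (k := 3) (by norm_num))
  have n4 := qpoch_ne_zero h5 (norm_pow_lt hq (k := 4) (by norm_num))
  have n5 := qpoch_ne_zero h5 h5
  have e1 : q ^ 5 / q = q ^ 4 := by field_simp
  have e2 : q ^ 5 / q ^ 2 = q ^ 3 := by field_simp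
  have e3 : q ^ 5 / q ^ 3 = q ^ 2 := by field_simp
  have t1 : tht (q ^ 5) q = qpoch q (q ^ 5) * qpoch (q ^ 4) (q ^ 5) := by unfold tht; rw [e1]
  have t2 : tht (q ^ 5) (q ^ 2) = qpoch (q ^ 2) (q ^ 5) * qpoch (q ^ 3) (q ^ 5) := by
    unfold tht; rw [e2]
  have t3 : tht (q ^ 5) (q ^ 3) = qpoch (q ^ 2) (q ^ 5) * qpoch (q ^ 3) (q ^ 5) := by
    unfold tht; rw [e3, mul_comm]
  rw [eis_eq hq hq0, wp_sub h5 (pow_ne_zero _ hq0) hq0 (pow_ne_zero _ hq0)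
    (by rw [t1]; exact mul_ne_zero n1 n4) (by rw [t2]; exact mul_ne_zero n2 n3)]
  have e4 : q ^ 2 / q = q := by field_simp
  have e5 : q ^ 2 * q = q ^ 3 := by ring
  rw [e4, e5, t1, t2, t3]
  unfold eul
  rw [qpoch_five hq]
  field_simp

lemma sqf_add_neg {x : ℂ} (hx : ‖x‖ < 1) : sqf x + sqf (-x) = 4 * sqf (x ^ 2) := by
  have h1 : 1 - x ≠ 0 := by
    intro h
    rw [← sub_eq_zero.1 h] at hx
    simp at hx
  have h2 : 1 + x ≠ 0 := by
    intro h
    rw [← neg_eq_of_add_eq_zero_right h] at hx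
    simp at hx
  have h3 : 1 - x ^ 2 ≠ 0 := by
    have : 1 - x ^ 2 = (1 - x) * (1 + x) := by ring
    rw [this]
    exact mul_ne_zero h1 h2
  unfold sqf
  rw [sub_neg_eq_add]
  field_simp
  ring

theorem eis_even {q : ℂ} (hq : ‖q‖ < 1) :
    eis q + eis (-q) = 2 * eis (q ^ 2) + 4 * eis (q ^ 4) := by
  have hq' : ‖-q‖ < 1 := by simpa using hq
  have h2 := norm_pow_lt hq (k := 2) (by norm_num)
  have h4 := norm_pow_lt hq (k := 4) (by norm_num)
  have i2 : Function.Injective (fun k : ℕ => 2 * k) := fun a b h => by simpa using h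
  have i3 : Function.Injective (fun k : ℕ => 2 * k + 1) := fun a b h => by simpa using h
  have key : ∀ x : ℂ, ‖x‖ < 1 → eis x = - eis (x ^ 2) +
      ∑' k : ℕ, chi (2 * k + 1) * sqf (x ^ (2 * k + 1)) := by
    intro x hx
    have hs := eis_summable hx
    have := tsum_even_add_odd (f := fun m : ℕ => chi m * sqf (x ^ m))
      (hs.comp_injective i2) (hs.comp_injective i3)
    unfold eis
    rw [← this, ← tsum_neg]
    congr 1
    refine tsum_congr fun k => ?_
    rw [chi_two, pow_mul]
    ring
  have k1 := key q hq
  have k2 := key (-q) hq'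
  have k3 := key (q ^ 2) h2
  have k4 : ∑' k : ℕ, chi (2 * k + 1) * sqf (q ^ (2 * k + 1)) +
      ∑' k : ℕ, chi (2 * k + 1) * sqf ((-q) ^ (2 * k + 1)) =
      4 * ∑' k : ℕ, chi (2 * k + 1) * sqf ((q ^ 2) ^ (2 * k + 1)) := by
    have s1 : Summable (fun k : ℕ => chi (2 * k + 1) * sqf (q ^ (2 * k + 1))) :=
      (eis_summable hq).comp_injective i3
    have s2 : Summable (fun k : ℕ => chi (2 * k + 1) * sqf ((-q) ^ (2 * k + 1))) :=
      (eis_summable hq').comp_injective i3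
    rw [← s1.tsum_add s2, ← tsum_mul_left]
    refine tsum_congr fun k => ?_
    have := sqf_add_neg (norm_pow_lt hq (k := 2 * k + 1) (by omega))
    rw [Odd.neg_pow ⟨k, rfl⟩, ← pow_mul, mul_comm 2 (2 * k + 1), pow_mul]
    linear_combination chi (2 * k + 1) * this
  have e1 : (-q) ^ 2 = q ^ 2 := by ring
  have e2 : (q ^ 2) ^ 2 = q ^ 4 := by ring
  rw [e1] at k2
  rw [e2] at k3
  linear_combination k1 + k2 + k4 - 4 * k3

lemma eul_neg {q : ℂ} (hq : ‖q‖ < 1) :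
    eul (-q) * (eul q * eul (q ^ 4)) = eul (q ^ 2) ^ 3 := by
  have hq' : ‖-q‖ < 1 := by simpa using hq
  have h2 := norm_pow_lt hq (k := 2) (by norm_num)
  have k1 := qpoch_two hq
  have k2 := qpoch_two hq'
  have k3 := qpoch_two h2
  have e1 : (-q) ^ 2 = q ^ 2 := by ring
  have e2 : (q ^ 2) ^ 2 = q ^ 4 := by ring
  rw [e1] at k2
  rw [e2] at k3
  have h4 : ‖q ^ 4‖ < 1 := norm_pow_lt hq (by norm_num)
  have k4 : qpoch q (q ^ 2) * qpoch (-q) (q ^ 2) = qpoch (q ^ 2) (q ^ 4) := by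
    unfold qpoch
    rw [← (qpoch_multipliable q h2).tprod_mul (qpoch_multipliable (-q) h2)]
    refine tprod_congr fun k => ?_
    ring
  unfold eul
  rw [k1, k2]
  calc _ = (qpoch q (q ^ 2) * qpoch (-q) (q ^ 2)) * qpoch (q ^ 4) (q ^ 4) *
        qpoch (q ^ 2) (q ^ 2) ^ 2 := by ring
    _ = _ := by rw [k4, ← k3]; ring

/-- The generating function. -/
noncomputable def gen (q : ℂ) : ℂ := psiNeg (q ^ 5) ^ 5 / psiNeg q

lemma psiNeg_eq (q : ℂ) : psiNeg q = eul q * eul (q ^ 4) / eul (q ^ 2) := rfl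

lemma psiNeg_ne {q : ℂ} (hq : ‖q‖ < 1) : psiNeg q ≠ 0 := by
  rw [psiNeg_eq]
  exact div_ne_zero (mul_ne_zero (eul_ne hq) (eul_ne (norm_pow_lt hq (by norm_num))))
    (eul_ne (norm_pow_lt hq (by norm_num)))

lemma gen_ne {q : ℂ} (hq : ‖q‖ < 1) : gen q ≠ 0 :=
  div_ne_zero (pow_ne_zero _ (psiNeg_ne (norm_pow_lt hq (by norm_num)))) (psiNeg_ne hq)

/-- The even cofactor. -/
noncomputable def cof (x : ℂ) : ℂ := eul (x ^ 10) ^ 5 * eul x / (eul (x ^ 5) ^ 5 * eul (x ^ 2))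

lemma gen_eq {q : ℂ} (hq : ‖q‖ < 1) (hq0 : q ≠ 0) : q * gen q = eis q * cof (q ^ 2) := by
  rw [eis_prod hq hq0]
  unfold gen cof
  rw [psiNeg_eq, psiNeg_eq]
  have n1 := eul_ne hq
  have n (k : ℕ) (hk : k ≠ 0) := eul_ne (norm_pow_lt hq hk)
  have n2 := n 2 (by norm_num)
  have n4 := n 4 (by norm_num)
  have n10 := n 10 (by norm_num)
  simp only [← pow_mul]
  norm_num
  field_simp

lemma psiNeg_neg {q : ℂ} (hq : ‖q‖ < 1) : psiNeg (-q) = eul (q ^ 2) ^ 2 / eul q := by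
  have h := eul_neg hq
  rw [psiNeg_eq]
  have e1 : (-q) ^ 2 = q ^ 2 := by ring
  have e2 : (-q) ^ 4 = q ^ 4 := by ring
  rw [e1, e2]
  have n1 := eul_ne hq
  have n2 := eul_ne (norm_pow_lt hq (k := 2) (by norm_num))
  field_simp
  linear_combination h

/-- Dissection of the generating function. -/
theorem gen_odd {q : ℂ} (hq : ‖q‖ < 1) (hq0 : q ≠ 0) :
    gen q - gen (-q) = 2 * q * (eul (q ^ 20) ^ 5 / eul (q ^ 4)) + 4 * q ^ 3 * gen (-(q ^ 2)) := by
  have hq' : ‖-q‖ < 1 := by simpa using hq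
  have h2 := norm_pow_lt hq (k := 2) (by norm_num)
  have h4 := norm_pow_lt hq (k := 4) (by norm_num)
  have h10 := norm_pow_lt hq (k := 10) (by norm_num)
  have h20 := norm_pow_lt hq (k := 20) (by norm_num)
  have g1 := gen_eq hq hq0
  have g2 := gen_eq hq' (neg_ne_zero.2 hq0)
  have ev := eis_even hq
  rw [eis_prod h2 (pow_ne_zero _ hq0), eis_prod h4 (pow_ne_zero _ hq0)] at ev
  have e1 : (-q) ^ 2 = q ^ 2 := by ring
  rw [e1] at g2
  have hc : gen (-(q ^ 2)) = eul (q ^ 20) ^ 10 * eul (q ^ 2) / (eul (q ^ 10) ^ 5 * eul (q ^ 4) ^ 2) := by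
    unfold gen
    have e2 : (-(q ^ 2)) ^ 5 = -(q ^ 10) := by ring
    rw [e2, psiNeg_neg h2, psiNeg_neg h10]
    simp only [← pow_mul]
    norm_num
    have n2 := eul_ne h2
    have n4 := eul_ne h4
    have n10 := eul_ne h10
    field_simp
  apply mul_left_cancel₀ hq0
  have step : q * (gen q - gen (-q)) = cof (q ^ 2) * (eis q + eis (-q)) := by
    linear_combination g1 + g2
  rw [step, ev, hc]
  unfold cof
  simp only [← pow_mul]
  norm_num
  have n2 := eul_ne h2
  have n4 := eul_ne h4
  have n10 := eul_ne h10
  have n20 := eul_ne h20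
  field_simp

lemma split_series {a : ℕ → ℂ} {q : ℂ} (hs : Summable (fun n => a n * q ^ n)) :
    Summable (fun k => a (2 * k) * (q ^ 2) ^ k) ∧
    (q ≠ 0 → Summable (fun k => a (2 * k + 1) * (q ^ 2) ^ k)) ∧
    ∑' n, a n * q ^ n = ∑' k, a (2 * k) * (q ^ 2) ^ k + q * ∑' k, a (2 * k + 1) * (q ^ 2) ^ k := by
  have i2 : Function.Injective (fun k : ℕ => 2 * k) := fun a b h => by simpa using h
  have i3 : Function.Injective (fun k : ℕ => 2 * k + 1) := fun a b h => by simpa using h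
  have s1 := hs.comp_injective i2
  have s2 := hs.comp_injective i3
  refine ⟨s1.congr fun k => ?_, fun h0 => (s2.mul_left q⁻¹).congr fun k => ?_, ?_⟩
  · simp [pow_mul]
  · simp only [Function.comp_apply]
    rw [← pow_mul]
    field_simp
    ring
  · rw [← tsum_even_add_odd (f := fun n => a n * q ^ n) s1 s2, ← tsum_mul_left]
    congr 1 <;> refine tsum_congr fun k => ?_ <;> ring

lemma coeff_zero {d : ℕ → ℂ} (h : ∀ y : ℂ, ‖y‖ < 1 → HasSum (fun n => d n * y ^ n) 0) (n : ℕ) :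
    d n = 0 := by
  have h1 : HasFPowerSeriesAt (fun _ : ℂ => (0 : ℂ)) (FormalMultilinearSeries.ofScalars ℂ d) 0 := by
    rw [hasFPowerSeriesAt_iff]
    filter_upwards [Metric.ball_mem_nhds (0 : ℂ) one_pos] with y hy
    refine (h y (by simpa using hy)).congr_fun ?_
    intro n
    simp [FormalMultilinearSeries.coeff_ofScalars, mul_comm]
  have h2 := h1.eq_zero
  have h3 := FormalMultilinearSeries.coeff_ofScalars (𝕜 := ℂ) (p := d) (n := n)
  rw [← h3, h2]
  rfl

theorem stmt_9 (b : ℕ → ℤ)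
    (hb : ∀ q : ℂ, ‖q‖ < 1 →
      ∑' n : ℕ, (b n : ℂ) * q ^ n = psiNeg (q ^ 5) ^ 5 / psiNeg q) :
    ∀ n : ℕ, b (4 * n + 3) = 2 * b (2 * n) := by
  have hg : ∀ q : ℂ, ‖q‖ < 1 → ∑' n : ℕ, (b n : ℂ) * q ^ n = gen q := hb
  have hs : ∀ q : ℂ, ‖q‖ < 1 → Summable (fun n : ℕ => (b n : ℂ) * q ^ n) := by
    intro q hq
    by_contra hc
    exact gen_ne hq ((hg q hq).symm.trans (tsum_eq_zero_of_not_summable hc))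
  have main : ∀ y : ℂ, ‖y‖ < 1 → y ≠ 0 →
      HasSum (fun k : ℕ => ((b (4 * k + 3) : ℂ) - 2 * b (2 * k)) * y ^ k) 0 := by
    intro y hy hy0
    obtain ⟨x, rfl⟩ : ∃ t : ℂ, y = t ^ 2 := by
      obtain ⟨t, ht⟩ := IsAlgClosed.exists_pow_nat_eq y (n := 2) (by norm_num)
      exact ⟨t, ht.symm⟩
    obtain ⟨q, rfl⟩ : ∃ t : ℂ, x = t ^ 2 := by
      obtain ⟨t, ht⟩ := IsAlgClosed.exists_pow_nat_eq x (n := 2) (by norm_num)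
      exact ⟨t, ht.symm⟩
    have hx0 : q ^ 2 ≠ 0 := fun h => hy0 (by simp [h])
    have hq0 : q ≠ 0 := fun h => hx0 (by simp [h])
    have hx : ‖q ^ 2‖ < 1 := by
      rw [norm_pow] at hy
      exact (pow_lt_one_iff_of_nonneg (norm_nonneg _) (by norm_num)).1 hy
    have hq : ‖q‖ < 1 := by
      rw [norm_pow] at hx
      exact (pow_lt_one_iff_of_nonneg (norm_nonneg _) (by norm_num)).1 hx
    -- odd part at q and at I q
    have odd : ∀ q : ℂ, ‖q‖ < 1 → q ≠ 0 →
        Summable (fun k : ℕ => (b (2 * k + 1) : ℂ) * (q ^ 2) ^ k) ∧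
        ∑' k : ℕ, (b (2 * k + 1) : ℂ) * (q ^ 2) ^ k =
          eul (q ^ 20) ^ 5 / eul (q ^ 4) + 2 * q ^ 2 * gen (-(q ^ 2)) := by
      intro q hq hq0
      have hq' : ‖-q‖ < 1 := by simpa using hq
      obtain ⟨-, s2, s3⟩ := split_series (a := fun n => (b n : ℂ)) (hs q hq)
      obtain ⟨-, -, t3⟩ := split_series (a := fun n => (b n : ℂ)) (hs (-q) hq')
      refine ⟨s2 hq0, ?_⟩
      have g := gen_odd hq hq0
      rw [← hg q hq, ← hg (-q) hq', s3, t3] at g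
      have e1 : (-q) ^ 2 = q ^ 2 := by ring
      rw [e1] at g
      apply mul_left_cancel₀ hq0
      linear_combination g / 2
    obtain ⟨o1, o2⟩ := odd q hq hq0
    obtain ⟨p1, p2⟩ := odd (Complex.I * q) (by simpa using hq)
      (mul_ne_zero Complex.I_ne_zero hq0)
    have i4 : Complex.I ^ 4 = 1 := Complex.I_pow_four
    have e20 : (Complex.I * q) ^ 20 = q ^ 20 := by
      rw [mul_pow, show (20 : ℕ) = 4 * 5 by norm_num, pow_mul, i4]; ring
    have e4 : (Complex.I * q) ^ 4 = q ^ 4 := by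
      rw [mul_pow, i4]; ring
    have e2 : (Complex.I * q) ^ 2 = -(q ^ 2) := by
      rw [mul_pow, Complex.I_sq]; ring
    rw [e20, e4, e2, neg_neg] at p2
    rw [e2] at p1
    generalize q ^ 2 = x at *
    have hx' : ‖-x‖ < 1 := by simpa using hx
    obtain ⟨-, a2, a3⟩ := split_series (a := fun n => (b (2 * n + 1) : ℂ)) o1
    obtain ⟨-, -, b3⟩ := split_series (a := fun n => (b (2 * n + 1) : ℂ)) p1
    obtain ⟨c1, -, c3⟩ := split_series (a := fun n => (b n : ℂ)) (hs x hx)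
    obtain ⟨-, -, d3⟩ := split_series (a := fun n => (b n : ℂ)) (hs (-x) hx')
    have e1 : (-x) ^ 2 = x ^ 2 := by ring
    rw [e1] at b3 d3
    rw [hg x hx] at c3
    rw [hg (-x) hx'] at d3
    rw [a3, d3] at o2
    rw [b3, c3] at p2
    have fin : ∑' k : ℕ, (b (2 * (2 * k + 1) + 1) : ℂ) * (x ^ 2) ^ k
        = 2 * ∑' k : ℕ, (b (2 * k) : ℂ) * (x ^ 2) ^ k := by
      apply mul_left_cancel₀ hx0
      linear_combination (o2 - p2) / 2
    have hh := (a2 hx0).hasSum.sub (c1.hasSum.mul_left 2)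
    rw [fin, sub_self] at hh
    refine hh.congr_fun fun k => ?_
    rw [show 2 * (2 * k + 1) + 1 = 4 * k + 3 by ring]
    ring
  intro n
  have h := coeff_zero (d := fun k => Nat.casesOn k 0
    (fun k => (b (4 * k + 3) : ℂ) - 2 * b (2 * k))) ?_ (n + 1)
  · have h' : (b (4 * n + 3) : ℂ) - 2 * b (2 * n) = 0 := h
    have h2 : (b (4 * n + 3) : ℂ) = ((2 * b (2 * n) : ℤ) : ℂ) := by
      push_cast
      linear_combination h'
    exact_mod_cast h2
  · intro y hy
    rw [hasSum_nat_add_iff' 1 |>.symm]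
    have e0 : (0 : ℂ) - ∑ i ∈ Finset.range 1, (Nat.casesOn i 0
        (fun k => (b (4 * k + 3) : ℂ) - 2 * b (2 * k)) : ℂ) * y ^ i = 0 := by
      simp
    rw [e0]
    by_cases hy0 : y = 0
    · simp [hy0, hasSum_zero]
    · have := (main y hy hy0).mul_right y
      rw [zero_mul] at this
      refine this.congr_fun fun k => ?_
      rw [pow_succ, mul_assoc]
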